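/- Let k, n, c be positive integers with 2^n < k < 2^(n+1) − 1 and c ≥ 3 odd. Then ν₂(S(c·2^n, k)) ≥ s₂(k). Moreover, ν₂(S(c·2^n, 2^(n+1) − 1)) = n. -/

import Mathlib

/-- Stirling numbers of the second kind. -/
def S : ℕ → ℕ → ℕ
  | 0, 0 => 1
  | 0, _ + 1 => 0
  | _ + 1, 0 => 0
  | n + 1, k + 1 => S n k + (k + 1) * S n (k + 1)

/-- Sum of binary digits. -/
def s₂ (n : ℕ) : ℕ := (Nat.digits 2 n).sum

open Finset Function fwdDiff

section DifferenceOperator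

variable {R : Type*} [CommRing R]

theorem fwdDiff_iter_succ_right_apply (f : ℕ → R) (m x : ℕ) :
    (Δ_[1])^[m] f (x + 1) = (Δ_[1])^[m] f x + (Δ_[1])^[m + 1] f x := by
  rw [iterate_succ_apply', fwdDiff]
  ring

theorem fwdDiff_iter_sub (f g : ℕ → R) (m : ℕ) :
    (Δ_[1])^[m] (f - g) = (Δ_[1])^[m] f - (Δ_[1])^[m] g := by
  rw [eq_sub_iff_add_eq, ← fwdDiff_iter_add, sub_add_cancel]

/-- The Leibniz rule for iterated forward differences. -/
theorem fwdDiff_iter_mul (f g : ℕ → R) (m x : ℕ) :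
    (Δ_[1])^[m] (f * g) x =
      ∑ p ∈ antidiagonal m, m.choose p.1 * ((Δ_[1])^[p.1] f x * (Δ_[1])^[p.2] g (x + p.1)) := by
  induction m generalizing x with
  | zero => simp
  | succ m ih =>
    rw [iterate_succ_apply', fwdDiff, ih, ih, Finset.sum_antidiagonal_choose_succ_mul
      (fun i j => (Δ_[1])^[i] f x * (Δ_[1])^[j] g (x + i)), ← sum_sub_distrib, ← sum_add_distrib]
    refine sum_congr rfl fun p hp => ?_
    have hc : m.choose p.2 = m.choose p.1 := by
      rw [← mem_antidiagonal.1 hp, Nat.choose_symm_add]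
    have h1 := fwdDiff_iter_succ_right_apply f p.1 x
    have h2 := fwdDiff_iter_succ_right_apply g p.2 (x + p.1)
    rw [hc, add_right_comm x 1 p.1, h1, ← add_assoc x p.1 1, h2]
    ring

end DifferenceOperator

section Divisibility

/-- The `m`-th difference of `f` at `0` is divisible by `d * 4 ^ m` for all `m ≤ M`. -/
def DvdDiff (d : ℤ) (M : ℕ) (f : ℕ → ℤ) : Prop :=
  ∀ m ≤ M, d * 4 ^ m ∣ (Δ_[1])^[m] f 0

variable {d : ℤ} {M : ℕ} {f g : ℕ → ℤ}

theorem DvdDiff.add (hf : DvdDiff d M f) (hg : DvdDiff d M g) : DvdDiff d M (f + g) := by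
  intro m hm
  rw [fwdDiff_iter_add]
  exact dvd_add (hf m hm) (hg m hm)

/-- Modulo higher powers of `4`, differences at `0` may be replaced by differences elsewhere. -/
theorem DvdDiff.dvd_sub (hf : DvdDiff d M f) {m x : ℕ} (hm : m + x ≤ M) :
    d * 4 ^ (m + 1) ∣ (Δ_[1])^[m] f x - (Δ_[1])^[m] f 0 := by
  have key : ∀ x m, m + x ≤ M → d * 4 ^ m ∣ (Δ_[1])^[m] f x := by
    intro x
    induction x with
    | zero => exact fun m hm => hf m hm
    | succ x ih =>
      intro m hm
      rw [fwdDiff_iter_succ_right_apply]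
      refine dvd_add (ih m (by omega)) ((mul_dvd_mul_left d (pow_dvd_pow 4 m.le_succ)).trans
        (ih (m + 1) (by omega)))
  induction x with
  | zero => simp
  | succ x ih =>
    rw [fwdDiff_iter_succ_right_apply, add_sub_right_comm]
    exact dvd_add (ih (by omega)) (key x (m + 1) (by omega))

theorem DvdDiff.dvd_apply (hf : DvdDiff d M f) {m x : ℕ} (hm : m + x ≤ M) :
    d * 4 ^ m ∣ (Δ_[1])^[m] f x := by
  rw [← sub_add_cancel ((Δ_[1])^[m] f x) ((Δ_[1])^[m] f 0)]
  exact dvd_add ((mul_dvd_mul_left d (pow_dvd_pow 4 m.le_succ)).trans (hf.dvd_sub hm))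
    (hf m (by omega))

theorem DvdDiff.mul (hf : DvdDiff 1 M f) (hg : DvdDiff d M g) : DvdDiff d M (f * g) := by
  intro m hm
  rw [fwdDiff_iter_mul]
  refine dvd_sum fun p hp => dvd_mul_of_dvd_right ?_ _
  rw [HasAntidiagonal.mem_antidiagonal] at hp
  have h1 := hf p.1 (by omega)
  have h2 : d * 4 ^ p.2 ∣ (Δ_[1])^[p.2] g (0 + p.1) := hg.dvd_apply (by omega)
  convert! mul_dvd_mul h1 h2 using 1
  rw [← hp, pow_add]
  ring

theorem two_dvd_sum_antidiagonal_choose_mul (b : ℕ → ℤ) {m : ℕ} (hm : 0 < m) :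
    2 ∣ ∑ p ∈ antidiagonal m, m.choose p.1 * (b p.1 * b p.2) := by
  refine (ZMod.intCast_zmod_eq_zero_iff_dvd _ 2).1 ?_
  push_cast
  refine sum_involution (fun p _ => p.swap) (fun p hp => ?_) (fun p hp hne heq => hne ?_)
    (fun p hp => by simpa [add_comm] using hp) (fun p _ => p.swap_swap)
  · have hc : m.choose p.2 = m.choose p.1 := by
      rw [← mem_antidiagonal.1 hp, Nat.choose_symm_add]
    simp only [Prod.fst_swap, Prod.snd_swap, hc]
    rw [mul_comm (b p.2 : ZMod 2)]
    exact CharTwo.add_self_eq_zero _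
  · have h12 : p.2 = p.1 := congrArg Prod.fst heq
    have hp' : m = 2 * p.1 := by rw [← mem_antidiagonal.1 hp, h12, two_mul]
    have : (m.choose p.1 : ZMod 2) = 0 := by
      rw [ZMod.natCast_eq_zero_iff, hp']
      exact Nat.two_dvd_centralBinom_of_one_le (by omega)
    rw [this, zero_mul]

theorem DvdDiff.two_mul_dvd_sq (hf : DvdDiff 1 M f) {m : ℕ} (hm0 : 0 < m) (hm : m ≤ M) :
    2 * 4 ^ m ∣ (Δ_[1])^[m] (f * f) 0 := by
  choose! b hb using hf
  have hb' : ∀ i ≤ M, (Δ_[1])^[i] f 0 = 4 ^ i * b i := fun i hi => by rw [hb i hi, one_mul]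
  have hmain : (Δ_[1])^[m] (f * f) 0 - 4 ^ m *
      ∑ p ∈ antidiagonal m, m.choose p.1 * (b p.1 * b p.2) =
      ∑ p ∈ antidiagonal m, m.choose p.1 *
        ((Δ_[1])^[p.1] f 0 * ((Δ_[1])^[p.2] f (0 + p.1) - (Δ_[1])^[p.2] f 0)) := by
    rw [fwdDiff_iter_mul, mul_sum, ← sum_sub_distrib]
    refine sum_congr rfl fun p hp => ?_
    rw [HasAntidiagonal.mem_antidiagonal] at hp
    rw [hb' p.1 (by omega), hb' p.2 (by omega), ← hp, pow_add]
    ring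
  rw [← sub_add_cancel ((Δ_[1])^[m] (f * f) 0) (4 ^ m *
    ∑ p ∈ antidiagonal m, m.choose p.1 * (b p.1 * b p.2)), hmain]
  refine dvd_add (dvd_sum fun p hp => dvd_mul_of_dvd_right ?_ _) ?_
  · rw [HasAntidiagonal.mem_antidiagonal] at hp
    have h1 : (4 : ℤ) ^ p.1 ∣ (Δ_[1])^[p.1] f 0 := ⟨_, hb' p.1 (by omega)⟩
    have hf : DvdDiff 1 M f := fun i hi => ⟨_, hb i hi⟩
    have h2 : 1 * (4 : ℤ) ^ (p.2 + 1) ∣ (Δ_[1])^[p.2] f (0 + p.1) - (Δ_[1])^[p.2] f 0 :=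
      hf.dvd_sub (by omega)
    refine Dvd.dvd.trans ⟨2, ?_⟩ (mul_dvd_mul h1 h2)
    rw [← hp]
    ring
  · rw [mul_comm]
    exact mul_dvd_mul_left _ (two_dvd_sum_antidiagonal_choose_mul b hm0)

end Divisibility

section ParitySums

mutual

/-- The sum `∑ i, k.choose (2 * i) * f i`, defined through Pascal's rule. -/
def evenSum : ℕ → (ℕ → ℤ) → ℤ
  | 0, f => f 0
  | k + 1, f => evenSum k f + oddSum k fun i => f (i + 1)

/-- The sum `∑ i, k.choose (2 * i + 1) * f i`, defined through Pascal's rule. -/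
def oddSum : ℕ → (ℕ → ℤ) → ℤ
  | 0, _ => 0
  | k + 1, f => oddSum k f + evenSum k f

end

theorem parity_sums_sub (k : ℕ) (f g : ℕ → ℤ) :
    evenSum k (f - g) = evenSum k f - evenSum k g ∧
      oddSum k (f - g) = oddSum k f - oddSum k g := by
  induction k generalizing f g with
  | zero => simp [evenSum, oddSum]
  | succ k ih =>
    have h := (ih (fun i => f (i + 1)) (fun i => g (i + 1))).2
    rw [evenSum, oddSum, evenSum, oddSum, evenSum, oddSum, (ih f g).1, (ih f g).2]
    refine ⟨?_, by ring⟩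
    change _ + oddSum k ((fun i => f (i + 1)) - fun i => g (i + 1)) = _
    rw [h]
    ring

theorem evenSum_sub (k : ℕ) (f g : ℕ → ℤ) :
    evenSum k (f - g) = evenSum k f - evenSum k g :=
  (parity_sums_sub k f g).1

theorem oddSum_sub (k : ℕ) (f g : ℕ → ℤ) : oddSum k (f - g) = oddSum k f - oddSum k g :=
  (parity_sums_sub k f g).2

theorem parity_sums_smul (k : ℕ) (a : ℤ) (f : ℕ → ℤ) :
    evenSum k (a • f) = a * evenSum k f ∧ oddSum k (a • f) = a * oddSum k f := by
  induction k generalizing f with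
  | zero => simp [evenSum, oddSum]
  | succ k ih =>
    have h := (ih fun i => f (i + 1)).2
    rw [evenSum, oddSum, evenSum, oddSum, (ih f).1, (ih f).2]
    refine ⟨?_, by ring⟩
    change _ + oddSum k (a • fun i => f (i + 1)) = _
    rw [h]
    ring

theorem oddSum_smul (k : ℕ) (a : ℤ) (f : ℕ → ℤ) : oddSum k (a • f) = a * oddSum k f :=
  (parity_sums_smul k a f).2

theorem evenSum_smul (k : ℕ) (a : ℤ) (f : ℕ → ℤ) : evenSum k (a • f) = a * evenSum k f :=
  (parity_sums_smul k a f).1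

theorem evenSum_succ_eq (k : ℕ) (f : ℕ → ℤ) :
    evenSum (k + 1) f = oddSum (k + 1) f + oddSum k (Δ_[1] f) := by
  change _ = _ + oddSum k ((fun i => f (i + 1)) - f)
  rw [evenSum, oddSum, oddSum_sub]
  ring

theorem oddSum_add_two (k : ℕ) (f : ℕ → ℤ) :
    oddSum (k + 2) f = 2 * oddSum (k + 1) f + oddSum k (Δ_[1] f) := by
  rw [oddSum, evenSum_succ_eq]
  ring

theorem oddSum_one (f : ℕ → ℤ) : oddSum 1 f = f 0 := by
  simp [evenSum, oddSum]

theorem oddSum_const (k : ℕ) (a : ℤ) : oddSum (k + 1) (fun _ => a) = 2 ^ k * a := by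
  induction k with
  | zero => simp [oddSum_one]
  | succ k ih =>
    rw [oddSum_add_two, ih, fwdDiff_const]
    have h := oddSum_smul k 0 (fun _ => 0)
    rw [zero_smul, zero_mul] at h
    change 2 * _ + oddSum k 0 = _
    rw [h]
    ring

theorem dvd_oddSum {d : ℤ} (k : ℕ) {f : ℕ → ℤ}
    (hf : ∀ m, 2 * m ≤ k → d ∣ 2 ^ (k - 2 * m) * (Δ_[1])^[m] f 0) : d ∣ oddSum (k + 1) f := by
  induction k using Nat.strong_induction_on generalizing f with
  | _ k ih =>
    match k with
    | 0 => simpa [oddSum_one] using hf 0 le_rfl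
    | k + 1 =>
      rw [oddSum_add_two, ← oddSum_smul]
      refine dvd_add (ih k k.lt_succ_self fun m hm => ?_) ?_
      · rw [fwdDiff_iter_const_smul, Pi.smul_apply, smul_eq_mul, ← mul_assoc, ← pow_succ,
          ← Nat.sub_add_comm hm]
        exact hf m (by omega)
      · match k with
        | 0 => simp [oddSum]
        | k + 1 =>
          refine ih k (by omega) fun m hm => ?_
          have h := hf (m + 1) (by omega)
          rwa [show k + 1 + 1 - 2 * (m + 1) = k - 2 * m by omega] at h

theorem dvd_oddSum_sub {d : ℤ} (M : ℕ) {f : ℕ → ℤ}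
    (hf : ∀ m < M, d ∣ 2 ^ (2 * M - 2 * m) * (Δ_[1])^[m] f 0) :
    d ∣ oddSum (2 * M + 1) f - (Δ_[1])^[M] f 0 := by
  induction M generalizing f with
  | zero => simp [oddSum_one]
  | succ M ih =>
    rw [show 2 * (M + 1) + 1 = 2 * M + 1 + 2 by ring, oddSum_add_two, ← oddSum_smul, add_sub_assoc]
    refine dvd_add (dvd_oddSum _ fun m hm => ?_) (ih fun m hm => ?_)
    · rw [fwdDiff_iter_const_smul, Pi.smul_apply, smul_eq_mul, ← mul_assoc, ← pow_succ,
        show 2 * M + 1 - 2 * m + 1 = 2 * (M + 1) - 2 * m by omega]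
      exact hf m (by omega)
    · have h := hf (m + 1) (by omega)
      rwa [show 2 * (M + 1) - 2 * (m + 1) = 2 * M - 2 * m by omega] at h

theorem DvdDiff.dvd_oddSum {d : ℤ} {M k : ℕ} {f : ℕ → ℤ} (hf : DvdDiff d M f)
    (hk : k ≤ 2 * M + 1) : d * 2 ^ k ∣ oddSum (k + 1) f := by
  refine _root_.dvd_oddSum k fun m hm => ?_
  refine Dvd.dvd.trans (Eq.dvd ?_) (mul_dvd_mul_left _ (hf m (by omega)))
  obtain ⟨j, rfl⟩ := Nat.exists_eq_add_of_le hm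
  rw [Nat.add_sub_cancel_left, pow_add, pow_mul]
  ring

theorem dvdDiff_of_dvd_oddSum {M : ℕ} {f : ℕ → ℤ}
    (hf : ∀ k ≤ 2 * M, (2 : ℤ) ^ k ∣ oddSum (k + 1) f) : DvdDiff 1 M f := by
  have key : ∀ m k, k + 2 * m ≤ 2 * M →
      (2 : ℤ) ^ (k + 2 * m) ∣ oddSum (k + 1) ((Δ_[1])^[m] f) := by
    intro m
    induction m with
    | zero => exact fun k hk => hf k hk
    | succ m ih =>
      intro k hk
      have h1 := ih (k + 2) (by omega)
      have h2 := mul_dvd_mul_left 2 (ih (k + 1) (by omega))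
      rw [← pow_succ'] at h2
      rw [iterate_succ_apply', ← add_sub_cancel_left (2 * oddSum (k + 1 + 1) ((Δ_[1])^[m] f))
        (oddSum (k + 1) _), ← oddSum_add_two]
      convert! _root_.dvd_sub h1 ((pow_dvd_pow 2 _).trans h2) using 2 <;> omega
  intro m hm
  have h := key m 0 (by omega)
  rwa [zero_add, zero_add, oddSum_one, pow_mul, show (2 : ℤ) ^ 2 = 4 by norm_num,
    ← one_mul ((4 : ℤ) ^ m)] at h

theorem fwdDiff_iter_zero_eq_evenSum_sub_oddSum (k : ℕ) (f : ℕ → ℤ) :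
    (-1) ^ k * (Δ_[1])^[k] f 0 =
      evenSum k (fun i => f (2 * i)) - oddSum k fun i => f (2 * i + 1) := by
  induction k generalizing f with
  | zero => simp [evenSum, oddSum]
  | succ k ih =>
    have h := ih (Δ_[1] f)
    have he : (fun i => Δ_[1] f (2 * i)) = (fun i => f (2 * i + 1)) - fun i => f (2 * i) := rfl
    have ho : (fun i => Δ_[1] f (2 * i + 1)) =
        (fun i => f (2 * (i + 1))) - fun i => f (2 * i + 1) := rfl
    rw [he, ho, evenSum_sub, oddSum_sub] at h
    rw [iterate_succ_apply, pow_succ, evenSum, oddSum]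
    linear_combination -h

end ParitySums

section Stirling

theorem S_eq_stirlingSecond (N k : ℕ) : S N k = Nat.stirlingSecond N k := by
  induction N generalizing k with
  | zero => cases k <;> simp [S]
  | succ N ih =>
    cases k with
    | zero => simp [S]
    | succ k => rw [S, Nat.stirlingSecond_succ_succ, ih, ih, add_comm]

theorem S_pos {N k : ℕ} (hk : 0 < k) (hkN : k ≤ N) : 0 < S N k := by
  induction N generalizing k with
  | zero => omega
  | succ N ih =>
    obtain ⟨k, rfl⟩ := Nat.exists_eq_succ_of_ne_zero hk.ne'
    rw [S]
    rcases (Nat.le_of_succ_le_succ hkN).eq_or_lt with rfl | h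
    · rw [S_eq_stirlingSecond, Nat.stirlingSecond_self]
      omega
    · exact Nat.add_pos_right _ (Nat.mul_pos k.succ_pos (ih k.succ_pos h))

/-- The function `i ↦ i ^ N`. -/
def powFun (N : ℕ) : ℕ → ℤ := fun i => (i : ℤ) ^ N

/-- The function `i ↦ (2 * i + 1) ^ N`. -/
def oddPowFun (N : ℕ) : ℕ → ℤ := fun i => (2 * (i : ℤ) + 1) ^ N

theorem oddPowFun_add (N N' : ℕ) : oddPowFun (N + N') = oddPowFun N * oddPowFun N' :=
  funext fun _ => pow_add _ _ _

theorem oddPowFun_zero_right (N : ℕ) : oddPowFun N 0 = 1 := by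
  simp [oddPowFun]

theorem fwdDiff_iter_natCast_mul (f : ℕ → ℤ) (k x : ℕ) :
    (Δ_[1])^[k + 1] (fun i : ℕ => (i : ℤ) * f i) x =
      x * (Δ_[1])^[k + 1] f x + (k + 1) * (Δ_[1])^[k] f (x + 1) := by
  induction k generalizing x with
  | zero =>
    simp only [zero_add, iterate_one, iterate_zero, id_eq, fwdDiff]
    push_cast
    ring
  | succ k ih =>
    have h1 := fwdDiff_iter_succ_right_apply f (k + 1) x
    have h2 := fwdDiff_iter_succ_right_apply f k (x + 1)
    rw [iterate_succ_apply', fwdDiff, ih, ih, h1, h2, h1]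
    push_cast
    ring

theorem fwdDiff_iter_powFun_zero (N k : ℕ) :
    (Δ_[1])^[k] (powFun N) 0 = (k.factorial * S N k : ℕ) := by
  induction N generalizing k with
  | zero =>
    have h : powFun 0 = fun _ => 1 := funext fun _ => pow_zero _
    rw [h]
    cases k with
    | zero => simp [S]
    | succ k =>
      rw [iterate_succ_apply, fwdDiff_const]
      change (Δ_[1])^[k] ((0 : ℤ) • fun _ => (0 : ℤ)) 0 = _
      rw [fwdDiff_iter_const_smul]
      simp [S]
  | succ N ih =>
    have h : powFun (N + 1) = fun i : ℕ => (i : ℤ) * powFun N i := funext fun _ => pow_succ' _ _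
    rw [h]
    cases k with
    | zero => simp [S]
    | succ k =>
      rw [fwdDiff_iter_natCast_mul, fwdDiff_iter_succ_right_apply, ih, ih, S, Nat.factorial_succ]
      push_cast
      ring

theorem neg_one_pow_mul_factorial_mul_S (N k : ℕ) :
    (-1) ^ k * ((k.factorial * S N k : ℕ) : ℤ) =
      2 ^ N * evenSum k (powFun N) - oddSum k (oddPowFun N) := by
  rw [← fwdDiff_iter_powFun_zero, fwdDiff_iter_zero_eq_evenSum_sub_oddSum, ← evenSum_smul]
  congr 2
  funext i
  simp [powFun, mul_pow]

/-- If the exponent `N` is large, `k! * S N k` agrees up to sign with the odd sum. -/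
theorem factorial_mul_S_modEq {N k : ℕ} (hk : k < N) :
    ((k + 1).factorial * S N (k + 1) : ℕ) ≡ (-1) ^ k * oddSum (k + 1) (oddPowFun N)
      [ZMOD 2 ^ (k + 1)] := by
  have h := neg_one_pow_mul_factorial_mul_S N (k + 1)
  have hs : ((-1 : ℤ) ^ k) * (-1) ^ k = 1 := by rw [← mul_pow]; simp
  obtain ⟨j, rfl⟩ := Nat.exists_eq_add_of_lt hk
  refine (Int.modEq_iff_dvd.2 ⟨(-1) ^ k * 2 ^ j * evenSum (k + 1) (powFun (k + j + 1)), ?_⟩)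
  rw [pow_succ] at h
  generalize (((k + 1).factorial * S (k + j + 1) (k + 1) : ℕ) : ℤ) = x at *
  linear_combination (-1) ^ k * h + x * hs

theorem neg_one_pow_mul_two_pow_modEq (j k : ℕ) :
    (-1) ^ j * (2 : ℤ) ^ k ≡ 2 ^ k [ZMOD 2 ^ (k + 1)] := by
  rcases neg_one_pow_eq_or ℤ j with h | h
  · rw [h, one_mul]
  · exact Int.modEq_iff_dvd.2 ⟨1, by rw [h]; ring⟩

theorem dvdDiff_sub_one {d : ℤ} {M : ℕ} {f : ℕ → ℤ} (h0 : f 0 = 1)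
    (hf : ∀ m ≤ M, 0 < m → d * 4 ^ m ∣ (Δ_[1])^[m] f 0) : DvdDiff d M (f - fun _ => 1) := by
  intro m hm
  rw [fwdDiff_iter_sub]
  cases m with
  | zero => simp [h0]
  | succ m =>
    have h : (Δ_[1])^[m + 1] (fun _ : ℕ => (1 : ℤ)) = 0 := by
      rw [iterate_succ_apply, fwdDiff_const]
      change (Δ_[1])^[m] ((0 : ℤ) • fun _ => (0 : ℤ)) = _
      rw [fwdDiff_iter_const_smul, zero_smul]
    rw [h, sub_zero]
    exact hf _ hm m.succ_pos

section PowersOfTwo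

variable {n : ℕ}

theorem dvdDiff_oddPowFun_sub_one (h : DvdDiff 1 (2 ^ n - 1) (oddPowFun (2 ^ n))) :
    DvdDiff 2 (2 ^ n - 1) (oddPowFun (2 ^ (n + 1)) - fun _ => 1) := by
  refine dvdDiff_sub_one (oddPowFun_zero_right _) fun m hm hm0 => ?_
  rw [pow_succ, mul_two, oddPowFun_add]
  exact h.two_mul_dvd_sq hm0 hm

theorem oddSum_modEq_of_lt (h : DvdDiff 1 (2 ^ n - 1) (oddPowFun (2 ^ n))) {k : ℕ}
    (hk : k < 2 ^ (n + 1)) :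
    oddSum (k + 1) (oddPowFun (2 ^ (n + 1))) ≡ 2 ^ k [ZMOD 2 ^ (k + 1)] := by
  have h2 := (dvdDiff_oddPowFun_sub_one h).dvd_oddSum (k := k) (by rw [pow_succ] at hk; omega)
  rw [oddSum_sub, oddSum_const, mul_one, ← pow_succ'] at h2
  exact (Int.modEq_iff_dvd.2 h2).symm

theorem fwdDiff_iter_powFun_modEq (h : DvdDiff 1 (2 ^ n - 1) (oddPowFun (2 ^ n))) {k : ℕ}
    (hk : k < 2 ^ (n + 1)) :
    (Δ_[1])^[k + 1] (powFun (2 ^ (n + 1))) 0 ≡ 2 ^ k [ZMOD 2 ^ (k + 1)] := by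
  rw [fwdDiff_iter_powFun_zero]
  exact ((factorial_mul_S_modEq hk).trans ((oddSum_modEq_of_lt h hk).mul_left _)).trans
    (neg_one_pow_mul_two_pow_modEq k k)

theorem dvd_of_modEq_two_pow {x : ℤ} {k : ℕ} (h : x ≡ 2 ^ k [ZMOD 2 ^ (k + 1)]) : 2 ^ k ∣ x :=
  (h.of_dvd (pow_dvd_pow 2 k.le_succ)).dvd_iff |>.2 dvd_rfl

theorem two_pow_dvd_fwdDiff_iter_powFun (h : DvdDiff 1 (2 ^ n - 1) (oddPowFun (2 ^ n)))
    (k : ℕ) : 2 ^ k ∣ (Δ_[1])^[k + 1] (powFun (2 ^ (n + 1))) 0 := by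
  rcases lt_or_ge k (2 ^ (n + 1)) with hk | hk
  · exact dvd_of_modEq_two_pow (fwdDiff_iter_powFun_modEq h hk)
  · rw [fwdDiff_iter_powFun_zero, S_eq_stirlingSecond,
      Nat.stirlingSecond_eq_zero_of_lt (Nat.lt_succ_of_le hk)]
    simp

theorem two_pow_dvd_two_pow_mul_fwdDiff_iter (h : DvdDiff 1 (2 ^ n - 1) (oddPowFun (2 ^ n)))
    {a b m : ℕ} (hab : a + 1 ≤ b + m) :
    2 ^ a ∣ 2 ^ b * (Δ_[1])^[m] (powFun (2 ^ (n + 1))) 0 := by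
  cases m with
  | zero => simp [powFun]
  | succ m =>
    refine Dvd.dvd.trans ?_ (mul_dvd_mul_left _ (two_pow_dvd_fwdDiff_iter_powFun h m))
    rw [← pow_add]
    exact pow_dvd_pow 2 (by omega)

theorem evenSum_powFun_modEq (h : DvdDiff 1 (2 ^ n - 1) (oddPowFun (2 ^ n))) {k : ℕ}
    (hk1 : 2 ^ (n + 1) ≤ k) (hk2 : k < 2 ^ (n + 2) - 1) :
    evenSum (k + 1) (powFun (2 ^ (n + 1))) ≡ oddSum (k + 1) (powFun (2 ^ (n + 1)))
      [ZMOD 2 ^ (k + 1 - 2 ^ (n + 1))] := by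
  have h2 : 2 ^ (n + 2) = 2 * 2 ^ (n + 1) := by ring
  have h1 : 0 < 2 ^ (n + 1) := by positivity
  refine (Int.modEq_iff_dvd.2 ?_).symm
  rw [evenSum_succ_eq, add_sub_cancel_left]
  obtain ⟨k, rfl⟩ := Nat.exists_eq_add_of_le' (h1.trans_le hk1)
  refine dvd_oddSum k fun m hm => ?_
  have := two_pow_dvd_two_pow_mul_fwdDiff_iter h (a := k + 0 + 1 + 1 - 2 ^ (n + 1))
    (b := k - 2 * m) (m := m + 1) (by omega)
  exact this

theorem oddSum_oddPowFun_eq {N k : ℕ} (hk : N < k) :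
    oddSum k (oddPowFun N) = 2 ^ N * evenSum k (powFun N) := by
  have h := neg_one_pow_mul_factorial_mul_S N k
  rw [S_eq_stirlingSecond, Nat.stirlingSecond_eq_zero_of_lt hk] at h
  simp only [mul_zero, Nat.cast_zero] at h
  linear_combination h

theorem two_pow_dvd_oddSum (h : DvdDiff 1 (2 ^ n - 1) (oddPowFun (2 ^ n))) {k : ℕ}
    (hk1 : 2 ^ (n + 1) ≤ k) (hk2 : k < 2 ^ (n + 2) - 2) :
    2 ^ (k + 1) ∣ oddSum (k + 1) (oddPowFun (2 ^ (n + 1))) := by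
  have h2 : 2 ^ (n + 2) = 2 * 2 ^ (n + 1) := by ring
  rw [oddSum_oddPowFun_eq (by omega), ← Nat.add_sub_cancel' (show 2 ^ (n + 1) ≤ k + 1 by omega),
    pow_add, Nat.add_sub_cancel' (show 2 ^ (n + 1) ≤ k + 1 by omega)]
  refine mul_dvd_mul_left _ (((evenSum_powFun_modEq h hk1 (by omega)).dvd_iff).2 ?_)
  exact dvd_oddSum k fun m hm => two_pow_dvd_two_pow_mul_fwdDiff_iter h (by omega)

theorem oddSum_modEq_top (h : DvdDiff 1 (2 ^ n - 1) (oddPowFun (2 ^ n))) :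
    oddSum (2 ^ (n + 2) - 1) (oddPowFun (2 ^ (n + 1))) ≡ 2 ^ (2 ^ (n + 2) - 2)
      [ZMOD 2 ^ (2 ^ (n + 2) - 1)] := by
  obtain ⟨j, hj⟩ : ∃ j, 2 ^ (n + 1) = j + 2 :=
    Nat.exists_eq_add_of_le' (Nat.le_self_pow n.succ_ne_zero 2)
  have h2 : 2 ^ (n + 2) = 2 * j + 4 := by rw [pow_succ, hj]; ring
  have he := evenSum_powFun_modEq h (k := 2 * j + 2) (by omega) (by omega)
  have ht : 2 ^ (j + 1) ∣ oddSum (2 * (j + 1) + 1) (powFun (2 ^ (n + 1))) -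
      (Δ_[1])^[j + 1] (powFun (2 ^ (n + 1))) 0 :=
    dvd_oddSum_sub _ fun m hm => two_pow_dvd_two_pow_mul_fwdDiff_iter h (by omega)
  have hb := fwdDiff_iter_powFun_modEq h (k := j) (by omega)
  rw [oddSum_oddPowFun_eq (by omega), h2]
  rw [hj] at *
  rw [show 2 * j + 2 + 1 - (j + 2) = j + 1 by omega] at he
  have := (he.trans (Int.modEq_iff_dvd.2 ht).symm).trans hb
  convert! this.mul_left' (c := 2 ^ (j + 2)) using 1
  · rw [← pow_add]
    congr 1
    omega
  · rw [← pow_add]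
    congr 1
    omega

theorem dvdDiff_oddPowFun (n : ℕ) : DvdDiff 1 (2 ^ n - 1) (oddPowFun (2 ^ n)) := by
  induction n with
  | zero =>
    intro m hm
    obtain rfl : m = 0 := by simpa using hm
    simp
  | succ n ih =>
    refine dvdDiff_of_dvd_oddSum fun k hk => ?_
    have h2 : 2 ^ (n + 2) = 2 * 2 ^ (n + 1) := by ring
    have h1 : 0 < 2 ^ (n + 1) := by positivity
    rcases lt_or_ge k (2 ^ (n + 1)) with hk1 | hk1
    · exact dvd_of_modEq_two_pow (oddSum_modEq_of_lt ih hk1)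
    · rcases lt_or_ge k (2 ^ (n + 2) - 2) with hk2 | hk2
      · exact (pow_dvd_pow 2 k.le_succ).trans (two_pow_dvd_oddSum ih hk1 hk2)
      · obtain rfl : k = 2 ^ (n + 2) - 2 := by omega
        rw [show 2 ^ (n + 2) - 2 + 1 = 2 ^ (n + 2) - 1 by omega]
        refine dvd_of_modEq_two_pow ?_
        rw [show 2 ^ (n + 2) - 2 + 1 = 2 ^ (n + 2) - 1 by omega]
        exact oddSum_modEq_top ih

end PowersOfTwo

/-- For odd `c`, passing from the exponent `2 ^ n` to `c * 2 ^ n` does not change the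
normalised differences modulo `2`. -/
theorem dvdDiff_oddPowFun_odd_mul (n c : ℕ) :
    DvdDiff 1 (2 ^ n - 1) (oddPowFun ((2 * c + 1) * 2 ^ n)) ∧
      DvdDiff 2 (2 ^ n - 1) (oddPowFun ((2 * c + 1) * 2 ^ n) - oddPowFun (2 ^ n)) := by
  induction c with
  | zero =>
    rw [mul_zero, zero_add, one_mul, sub_self]
    refine ⟨dvdDiff_oddPowFun n, fun m _ => ?_⟩
    have h := fwdDiff_iter_sub (oddPowFun 0) (oddPowFun 0) m
    rw [sub_self, sub_self] at h
    rw [h]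
    exact dvd_zero _
  | succ c ih =>
    have hm := ih.1.mul (dvdDiff_oddPowFun_sub_one (dvdDiff_oddPowFun n))
    have he : (2 * (c + 1) + 1) * 2 ^ n = (2 * c + 1) * 2 ^ n + 2 ^ (n + 1) := by ring
    have hm1 : DvdDiff 1 (2 ^ n - 1) (oddPowFun ((2 * c + 1) * 2 ^ n) *
        (oddPowFun (2 ^ (n + 1)) - fun _ => 1)) := fun m h =>
      (mul_dvd_mul_right (one_dvd 2) _).trans (hm m h)
    rw [he, oddPowFun_add]
    constructor
    · convert! ih.1.add hm1 using 1
      funext i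
      simp only [Pi.add_apply, Pi.mul_apply, Pi.sub_apply]
      ring
    · convert! ih.2.add hm using 1
      funext i
      simp only [Pi.add_apply, Pi.mul_apply, Pi.sub_apply]
      ring

theorem oddSum_odd_mul_modEq {n c k : ℕ} (hc : Odd c) (hk : k < 2 ^ (n + 1)) :
    oddSum (k + 1) (oddPowFun (c * 2 ^ n)) ≡ oddSum (k + 1) (oddPowFun (2 ^ n))
      [ZMOD 2 ^ (k + 1)] := by
  obtain ⟨c, rfl⟩ := hc
  have h := (dvdDiff_oddPowFun_odd_mul n c).2.dvd_oddSum (k := k) (by rw [pow_succ] at hk; omega)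
  rw [oddSum_sub, ← pow_succ'] at h
  exact (Int.modEq_iff_dvd.2 h).symm

theorem padicValNat_factorial_add_s₂ (k : ℕ) : padicValNat 2 k.factorial + s₂ k = k := by
  have h := sub_one_mul_padicValNat_factorial (p := 2) k
  rw [Nat.add_one_sub_one, one_mul] at h
  rw [h, s₂]
  exact Nat.sub_add_cancel (Nat.digit_sum_le 2 k)

theorem s₂_two_pow_sub_one (n : ℕ) : s₂ (2 ^ n - 1) = n := by
  induction n with
  | zero => simp [s₂]
  | succ n ih =>
    have h : 2 ^ (n + 1) - 1 = 1 + 2 * (2 ^ n - 1) := by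
      have := Nat.one_le_two_pow (n := n)
      rw [pow_succ]
      omega
    rw [s₂] at ih ⊢
    rw [h, Nat.digits_add 2 one_lt_two 1 _ one_lt_two (Or.inl one_ne_zero), List.sum_cons, ih,
      add_comm]

end Stirling

theorem stmt14 (k n c : ℕ) (hn : 0 < n) (hc : 3 ≤ c) (hodd : Odd c)
    (hk1 : 2 ^ n < k) (hk2 : k < 2 ^ (n + 1) - 1) :
    s₂ k ≤ padicValNat 2 (S (c * 2 ^ n) k) ∧
      padicValNat 2 (S (c * 2 ^ n) (2 ^ (n + 1) - 1)) = n := by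
  obtain ⟨n, rfl⟩ := Nat.exists_eq_succ_of_ne_zero hn.ne'
  rw [Nat.succ_eq_add_one] at *
  have h2 : 2 ^ (n + 1 + 1) = 2 * 2 ^ (n + 1) := by ring
  have h2' : 2 ^ (n + 2) = 2 * 2 ^ (n + 1) := h2
  have hcn : 3 * 2 ^ (n + 1) ≤ c * 2 ^ (n + 1) := Nat.mul_le_mul_right _ hc
  have hmod : ∀ j, j < 2 ^ (n + 1 + 1) →
      ((j + 1).factorial * S (c * 2 ^ (n + 1)) (j + 1) : ℕ) ≡
        (-1) ^ j * oddSum (j + 1) (oddPowFun (2 ^ (n + 1))) [ZMOD 2 ^ (j + 1)] := fun j hj =>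
    (factorial_mul_S_modEq (by omega)).trans ((oddSum_odd_mul_modEq hodd hj).mul_left _)
  have hval : ∀ j, 0 < j → j < 2 ^ (n + 1 + 1) →
      padicValNat 2 (j.factorial * S (c * 2 ^ (n + 1)) j) + s₂ j =
        j + padicValNat 2 (S (c * 2 ^ (n + 1)) j) := fun j hj0 hj => by
    rw [padicValNat.mul j.factorial_ne_zero (S_pos hj0 (by omega)).ne']
    have := padicValNat_factorial_add_s₂ j
    omega
  have hne : ∀ j, 0 < j → j < 2 ^ (n + 1 + 1) → j.factorial * S (c * 2 ^ (n + 1)) j ≠ 0 :=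
    fun j hj0 hj => mul_ne_zero j.factorial_ne_zero (S_pos hj0 (by omega)).ne'
  constructor
  · obtain ⟨k, rfl⟩ := Nat.exists_eq_add_of_le' (show 1 ≤ k by omega)
    have hd : ((2 ^ (k + 1) : ℕ) : ℤ) ∣
        ((k + 1).factorial * S (c * 2 ^ (n + 1)) (k + 1) : ℕ) := by
      have h := ((hmod k (by omega)).dvd_iff).2 (dvd_mul_of_dvd_right
        (two_pow_dvd_oddSum (dvdDiff_oddPowFun n) (k := k) (by omega) (by omega)) _)
      exact_mod_cast h
    have h := (padicValNat_dvd_iff_le (hne (k + 1) (by omega) (by omega))).1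
      (Int.natCast_dvd_natCast.1 hd)
    have := hval (k + 1) (by omega) (by omega)
    omega
  · obtain ⟨j, hj⟩ : ∃ j, 2 ^ (n + 1 + 1) - 1 = j + 1 := Nat.exists_eq_add_of_le' (by omega)
    have ht := oddSum_modEq_top (dvdDiff_oddPowFun n)
    rw [show n + 2 = n + 1 + 1 from rfl, show 2 ^ (n + 1 + 1) - 2 = j by omega, hj] at ht
    have hx := ((hmod j (by omega)).trans (ht.mul_left _)).trans
      (neg_one_pow_mul_two_pow_modEq j j)
    have hx' := (Int.natCast_modEq_iff (a := (j + 1).factorial * S (c * 2 ^ (n + 1)) (j + 1))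
      (b := 2 ^ j) (n := 2 ^ (j + 1))).1 (by exact_mod_cast hx)
    have h0 := hne (j + 1) (by omega) (by omega)
    have hge := (padicValNat_dvd_iff_le h0).1
      ((hx'.dvd_iff (pow_dvd_pow 2 j.le_succ)).2 dvd_rfl)
    have hlt : ¬ j + 1 ≤ padicValNat 2 ((j + 1).factorial * S (c * 2 ^ (n + 1)) (j + 1)) := by
      rw [← padicValNat_dvd_iff_le h0, hx'.dvd_iff dvd_rfl, Nat.pow_dvd_pow_iff_le_right one_lt_two]
      omega
    have hs := s₂_two_pow_sub_one (n + 1 + 1)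
    have := hval (j + 1) (by omega) (by omega)
    rw [hj] at hs ⊢
    omega
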